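/- Over the ring R = F₃[t, t⁻¹] of Laurent polynomials over the field with three elements, the ternary quadratic form q'(x,y,z) = x² + y² + t z² is anisotropic (q'(x,y,z) = 0 with x,y,z ∈ R implies x = y = z = 0), whereas q(x,y,z) = x² − y² − t z² is isotropic; moreover q and q' become properly isomorphic (by a determinant-1 change of variables, e.g. (x,y,z) ↦ (x, iy, −iz) with i² = −1) over the quadratic extension F₉[t, t⁻¹]. -/

import Mathlib

open LaurentPolynomial

/-- If `x² + y²` is anisotropic over the field `k`, any solution of `p² + q² + X r² = 0`
over `k[X]` is divisible by every power of `X`. -/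
theorem Polynomial.X_pow_dvd_of_sq_add_sq_add_X_mul_sq_eq_zero {k : Type*} [Field k]
    (hk : ∀ a b : k, a ^ 2 + b ^ 2 = 0 → a = 0 ∧ b = 0) (n : ℕ) (p q r : Polynomial k)
    (h : p ^ 2 + q ^ 2 + Polynomial.X * r ^ 2 = 0) :
    Polynomial.X ^ n ∣ p ∧ Polynomial.X ^ n ∣ q ∧ Polynomial.X ^ n ∣ r := by
  induction n generalizing p q r with
  | zero => simp
  | succ n ih =>
    have h₀ := congrArg (Polynomial.eval 0) h
    simp only [Polynomial.eval_add, Polynomial.eval_pow, Polynomial.eval_mul, Polynomial.eval_X,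
      zero_mul, add_zero, Polynomial.eval_zero] at h₀
    obtain ⟨hp, hq⟩ := hk _ _ h₀
    rw [← Polynomial.coeff_zero_eq_eval_zero, ← Polynomial.X_dvd_iff] at hp hq
    obtain ⟨p', rfl⟩ := hp
    obtain ⟨q', rfl⟩ := hq
    have h₁ : Polynomial.X * (p' ^ 2 + q' ^ 2) + r ^ 2 = 0 :=
      mul_left_cancel₀ Polynomial.X_ne_zero (by linear_combination h)
    have hr : Polynomial.X ∣ r :=
      Polynomial.prime_X.dvd_of_dvd_pow (n := 2) ⟨-(p' ^ 2 + q' ^ 2), by linear_combination h₁⟩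
    obtain ⟨r', rfl⟩ := hr
    have h₂ : p' ^ 2 + q' ^ 2 + Polynomial.X * r' ^ 2 = 0 :=
      mul_left_cancel₀ Polynomial.X_ne_zero (by linear_combination h₁)
    obtain ⟨hp, hq, hr⟩ := ih p' q' r' h₂
    simp only [pow_succ']
    exact ⟨mul_dvd_mul_left _ hp, mul_dvd_mul_left _ hq, mul_dvd_mul_left _ hr⟩

theorem Polynomial.eq_zero_of_forall_X_pow_dvd {k : Type*} [Semiring k] {p : Polynomial k}
    (h : ∀ n : ℕ, Polynomial.X ^ n ∣ p) : p = 0 := by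
  ext n
  simpa using Polynomial.X_pow_dvd_iff.mp (h (n + 1)) n n.lt_succ_self

/-- The form `x² + y² + t z²` is anisotropic over `k[t, t⁻¹]` if `x² + y²` is so over `k`. -/
theorem LaurentPolynomial.eq_zero_of_sq_add_sq_add_T_mul_sq_eq_zero {k : Type*} [Field k]
    (hk : ∀ a b : k, a ^ 2 + b ^ 2 = 0 → a = 0 ∧ b = 0) (x y z : LaurentPolynomial k)
    (h : x ^ 2 + y ^ 2 + T 1 * z ^ 2 = 0) : x = 0 ∧ y = 0 ∧ z = 0 := by
  obtain ⟨a, p, hp⟩ := exists_T_pow x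
  obtain ⟨b, q, hq⟩ := exists_T_pow y
  obtain ⟨c, r, hr⟩ := exists_T_pow z
  have hpoly : (p * Polynomial.X ^ (b + c)) ^ 2 + (q * Polynomial.X ^ (a + c)) ^ 2
      + Polynomial.X * (r * Polynomial.X ^ (a + b)) ^ 2 = 0 := by
    apply Polynomial.toLaurent_injective
    simp only [map_add, map_mul, map_pow, map_zero, Polynomial.toLaurent_X, hp, hq, hr]
    have hT (n : ℕ) : (T n : LaurentPolynomial k) = T 1 ^ n := by simp [T_pow]
    simp only [hT]
    linear_combination (T 1 ^ (a + b + c)) ^ 2 * h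
  have hdvd n := Polynomial.X_pow_dvd_of_sq_add_sq_add_X_mul_sq_eq_zero hk n _ _ _ hpoly
  have hX (n : ℕ) : (Polynomial.X ^ n : Polynomial k) ≠ 0 := pow_ne_zero _ Polynomial.X_ne_zero
  have cancel {w : LaurentPolynomial k} {s : Polynomial k} {m n : ℕ}
      (hs : Polynomial.toLaurent s = w * T m)
      (hd : ∀ l : ℕ, Polynomial.X ^ l ∣ s * Polynomial.X ^ n) :
      w = 0 := by
    have hs₀ := (mul_eq_zero.mp (Polynomial.eq_zero_of_forall_X_pow_dvd hd)).resolve_right (hX n)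
    rw [hs₀, map_zero] at hs
    exact (isUnit_T (m : ℤ)).mul_left_eq_zero.mp hs.symm
  exact ⟨cancel hp fun n => (hdvd n).1, cancel hq fun n => (hdvd n).2.1,
    cancel hr fun n => (hdvd n).2.2⟩

theorem GaloisField.exists_sq_eq_neg_one : ∃ i : GaloisField 3 2, i ^ 2 = -1 := by
  have := Fintype.ofFinite (GaloisField 3 2)
  have hcard : Fintype.card (GaloisField 3 2) = 3 ^ 2 := by
    rw [← Nat.card_eq_fintype_card, GaloisField.card 3 2 two_ne_zero]
  obtain ⟨i, hi⟩ := FiniteField.isSquare_neg_one_iff.mpr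
    (show Fintype.card (GaloisField 3 2) % 4 ≠ 3 by rw [hcard]; norm_num)
  exact ⟨i, by rw [sq, hi]⟩

/-- Over the ring `R = 𝔽₃[t, t⁻¹]` of Laurent polynomials over the field
with three elements (the Hasse domain of `K = 𝔽₃(t)` for `S = {t, t⁻¹}`), the ternary
quadratic form `q'(x,y,z) = x² + y² + t·z²` is anisotropic, whereas
`q(x,y,z) = x² − y² − t·z²` is isotropic; moreover `q` and `q'` become properly isomorphic
— by the determinant-1 change of variables `(x, y, z) ↦ (x, i·y, −i·z)` with `i² = −1` —
over the quadratic extension `𝔽₉[t, t⁻¹]`, where `𝔽₉ = 𝔽₃(i)` is realized as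
`GaloisField 3 2`. -/
theorem laurent_example_anisotropic_isotropic_properly_isomorphic :
    -- q'(x,y,z) = x² + y² + t z² is anisotropic over 𝔽₃[t,t⁻¹]
    (∀ x y z : LaurentPolynomial (ZMod 3),
      x ^ 2 + y ^ 2 + T 1 * z ^ 2 = 0 → x = 0 ∧ y = 0 ∧ z = 0)
    -- q(x,y,z) = x² − y² − t z² is isotropic over 𝔽₃[t,t⁻¹]
    ∧ (∃ x y z : LaurentPolynomial (ZMod 3),
      ¬(x = 0 ∧ y = 0 ∧ z = 0) ∧ x ^ 2 - y ^ 2 - T 1 * z ^ 2 = 0)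
    -- over 𝔽₉[t,t⁻¹], with i ∈ 𝔽₉ satisfying i² = −1, the diagonal substitution
    -- diag(1, i, −i), of determinant 1, transforms q' into q
    ∧ (∃ i : GaloisField 3 2, i ^ 2 = -1 ∧
        (Matrix.diagonal
          ![(1 : LaurentPolynomial (GaloisField 3 2)), C i, -(C i)]).det = 1 ∧
        ∀ x y z : LaurentPolynomial (GaloisField 3 2),
          x ^ 2 - y ^ 2 - T 1 * z ^ 2 =
            x ^ 2 + (C i * y) ^ 2 + T 1 * (-(C i) * z) ^ 2) := by
  refine ⟨LaurentPolynomial.eq_zero_of_sq_add_sq_add_T_mul_sq_eq_zero (by decide),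
    ⟨1, 1, 0, by simp, by simp⟩, ?_⟩
  obtain ⟨i, hi⟩ := GaloisField.exists_sq_eq_neg_one
  have hC : (C i : LaurentPolynomial (GaloisField 3 2)) ^ 2 = -1 := by
    rw [← map_pow, hi, map_neg, map_one]
  refine ⟨i, hi, ?_, fun x y z => ?_⟩
  · rw [Matrix.det_diagonal, Fin.prod_univ_three]
    simp only [Matrix.cons_val]
    linear_combination -hC
  · linear_combination (-y ^ 2 - T 1 * z ^ 2) * hC
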